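/- arXiv:2212.13811 — 2 statements merged into one kernel-verified Lean document; each statement's English description precedes it below -/
import Mathlib

section
/- The linear map ω ↦ ⋆(Φ ∧ ω) on 2-forms of ℝ^8 satisfies the identity (⋆(Φ ∧ ·) - 3·Id)(⋆(Φ ∧ ·) + Id) = 0; i.e., for every 2-form ω, ⋆(Φ ∧ ⋆(Φ ∧ ω)) = 2⋆(Φ ∧ ω) + 3ω. -/
open Finset

noncomputable section

/-- The exterior algebra of (ℝ^8)*, modeled as coefficient functions on basis index sets. -/
abbrev Form := Finset (Fin 8) → ℝ

/-- Sign `(-1)^{#{(i,j) ∈ t × u : j < i}}` arising when merging two wedge monomials. -/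
def esign (t u : Finset (Fin 8)) : ℝ :=
  (-1 : ℝ) ^ ((t ×ˢ u).filter (fun p => p.2 < p.1)).card

/-- Wedge product of forms. -/
def wedge (α β : Form) : Form := fun s =>
  ∑ t ∈ s.powerset, esign t (s \ t) * α t * β (s \ t)

/-- Hodge star for the standard Euclidean metric and orientation `e^{01234567}`,
characterized by `α ∧ ⋆β = ⟨α,β⟩ vol`. -/
def hodge (α : Form) : Form := fun u => esign uᶜ u * α uᶜ

/-- Inner product on forms, making the basis monomials orthonormal. -/
def formInner (α β : Form) : ℝ := ∑ s : Finset (Fin 8), α s * β s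

/-- Basis monomial `e^{i₁} ∧ ⋯ ∧ e^{i_k}` for `s = {i₁ < ⋯ < i_k}`. -/
def eS (s : Finset (Fin 8)) : Form := fun t => if t = s then 1 else 0

/-- `α` is a `k`-form. -/
def IsForm (k : ℕ) (α : Form) : Prop := ∀ s, s.card ≠ k → α s = 0

/-- The standard Cayley (Spin(7)) 4-form on ℝ^8. -/
def Phi : Form :=
  eS {0,1,2,3} - eS {0,1,4,5} - eS {0,1,6,7} - eS {0,2,4,6} + eS {0,2,5,7}
  - eS {0,3,4,7} - eS {0,3,5,6} + eS {4,5,6,7} - eS {2,3,6,7} - eS {2,3,4,5}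
  - eS {1,3,5,7} + eS {1,3,4,6} - eS {1,2,5,6} - eS {1,2,4,7}

/-- Interior product with the basis vector `e_i`. -/
def iota (i : Fin 8) (α : Form) : Form := fun s =>
  if i ∈ s then 0 else (-1 : ℝ) ^ (s.filter (· < i)).card * α (insert i s)

/-- Interior product with the vector `v`. -/
def iotaV (v : Fin 8 → ℝ) (α : Form) : Form := fun s => ∑ i, v i * iota i α s

/-- Musical isomorphism `♭ : ℝ^8 → Λ¹(ℝ^8)*`. -/
def flat (v : Fin 8 → ℝ) : Form := fun s => ∑ i, v i * eS {i} s

/-- Projection onto `Λ²_7` (eigenvalue 3 of `ω ↦ ⋆(Φ ∧ ω)`). -/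
def proj7 (α : Form) : Form := (4 : ℝ)⁻¹ • (α + hodge (wedge Phi α))

/-- Projection onto `Λ²_21` (eigenvalue -1 of `ω ↦ ⋆(Φ ∧ ω)`). -/
def proj21 (α : Form) : Form := (4 : ℝ)⁻¹ • ((3 : ℝ) • α - hodge (wedge Phi α))

/-- Evaluation of a 4-form on four vectors. -/
def ev4 (α : Form) (x y z w : Fin 8 → ℝ) : ℝ :=
  iotaV w (iotaV z (iotaV y (iotaV x α))) ∅

/-- Standard inner product on ℝ^8. -/
def dot (u v : Fin 8 → ℝ) : ℝ := ∑ i, u i * v i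

/-- Standard basis vector. -/
def std (i : Fin 8) : Fin 8 → ℝ := fun j => if j = i then 1 else 0

end

noncomputable section

/-- Integer version of the merging sign. -/
def esignZ (t u : Finset (Fin 8)) : ℤ :=
  (-1 : ℤ) ^ ((t ×ˢ u).filter (fun p => p.2 < p.1)).card

lemma esign_cast (t u : Finset (Fin 8)) : esign t u = (esignZ t u : ℝ) := by
  simp [esign, esignZ]

/-- The monomials of the Cayley form with their signs. -/
def phiList : List (ℤ × Finset (Fin 8)) :=
  [(1, {0,1,2,3}), (-1, {0,1,4,5}), (-1, {0,1,6,7}), (-1, {0,2,4,6}), (1, {0,2,5,7}),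
   (-1, {0,3,4,7}), (-1, {0,3,5,6}), (1, {4,5,6,7}), (-1, {2,3,6,7}), (-1, {2,3,4,5}),
   (-1, {1,3,5,7}), (1, {1,3,4,6}), (-1, {1,2,5,6}), (-1, {1,2,4,7})]

/-- Evaluate a formal integer combination of coefficients. -/
def evalL (l : List (ℤ × Finset (Fin 8))) (β : Form) : ℝ :=
  (l.map (fun p => (p.1 : ℝ) * β p.2)).sum

/-- The row of the matrix of `⋆(Φ ∧ ·)` at `u`. -/
def row (u : Finset (Fin 8)) : List (ℤ × Finset (Fin 8)) :=
  (phiList.filter (fun p => p.2 ⊆ uᶜ)).map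
    (fun p => (esignZ uᶜ u * esignZ p.2 (uᶜ \ p.2) * p.1, uᶜ \ p.2))

/-- Scaling a formal combination. -/
def scaleL (c : ℤ) (l : List (ℤ × Finset (Fin 8))) : List (ℤ × Finset (Fin 8)) :=
  l.map (fun p => (c * p.1, p.2))

lemma evalL_nil (β : Form) : evalL [] β = 0 := by simp [evalL]

lemma evalL_cons (p : ℤ × Finset (Fin 8)) (l : List (ℤ × Finset (Fin 8))) (β : Form) :
    evalL (p :: l) β = p.1 * β p.2 + evalL l β := by simp [evalL]

lemma evalL_append (l m : List (ℤ × Finset (Fin 8))) (β : Form) :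
    evalL (l ++ m) β = evalL l β + evalL m β := by simp [evalL]

lemma evalL_scale (c : ℤ) (l : List (ℤ × Finset (Fin 8))) (β : Form) :
    evalL (scaleL c l) β = c * evalL l β := by
  induction l with
  | nil => simp [evalL, scaleL]
  | cons p l ih =>
    have : scaleL c (p :: l) = (c * p.1, p.2) :: scaleL c l := rfl
    rw [this, evalL_cons, evalL_cons, ih]; push_cast; ring

lemma Phi_eq (t : Finset (Fin 8)) :
    Phi t = (phiList.map (fun p => (p.1 : ℝ) * eS p.2 t)).sum := by
  simp [Phi, phiList]; ring

lemma wedge_list (l : List (ℤ × Finset (Fin 8))) (β : Form) (s : Finset (Fin 8)) :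
    wedge (fun t => (l.map (fun p => (p.1 : ℝ) * eS p.2 t)).sum) β s =
    evalL ((l.filter (fun p => p.2 ⊆ s)).map
      (fun p => (esignZ p.2 (s \ p.2) * p.1, s \ p.2))) β := by
  induction l with
  | nil => simp [wedge, evalL]
  | cons p l ih =>
    have h1 : wedge (fun t => ((p :: l).map (fun p => (p.1 : ℝ) * eS p.2 t)).sum) β s
        = (∑ t ∈ s.powerset, esign t (s \ t) * (p.1 * eS p.2 t) * β (s \ t)) +
          wedge (fun t => (l.map (fun p => (p.1 : ℝ) * eS p.2 t)).sum) β s := by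
      simp only [wedge, List.map_cons, List.sum_cons, ← Finset.sum_add_distrib]
      refine Finset.sum_congr rfl fun t _ => ?_
      ring
    have h2 : (∑ t ∈ s.powerset, esign t (s \ t) * (p.1 * eS p.2 t) * β (s \ t)) =
        if p.2 ⊆ s then esign p.2 (s \ p.2) * p.1 * β (s \ p.2) else 0 := by
      simp [eS, Finset.sum_ite_eq']
    rw [h1, h2, ih]
    by_cases h : p.2 ⊆ s
    · simp [h, evalL_cons, esign_cast]
    · simp [h]

lemma T_eq (β : Form) (u : Finset (Fin 8)) : hodge (wedge Phi β) u = evalL (row u) β := by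
  have hP : Phi = fun t => (phiList.map (fun p => (p.1 : ℝ) * eS p.2 t)).sum := funext Phi_eq
  have hr : row u = scaleL (esignZ uᶜ u) ((phiList.filter (fun p => p.2 ⊆ uᶜ)).map
      (fun p => (esignZ p.2 (uᶜ \ p.2) * p.1, uᶜ \ p.2))) := by
    simp [row, scaleL, mul_assoc]
  rw [hr, evalL_scale, ← wedge_list, ← hP, ← esign_cast]
  rfl

lemma row_card (u : Finset (Fin 8)) (p : ℤ × Finset (Fin 8)) (hp : p ∈ row u) :
    p.2.card + u.card = 4 := by
  have h4 : ∀ q ∈ phiList, q.2.card = 4 := by decide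
  simp only [row, List.mem_map, List.mem_filter, decide_eq_true_eq] at hp
  obtain ⟨q, ⟨hq, hs⟩, rfl⟩ := hp
  have h1 := Finset.card_sdiff_add_card_eq_card hs
  have h2 := Finset.card_compl_add_card u
  have h3 := h4 q hq
  simp only [Fintype.card_fin] at h2
  simp only
  omega

lemma row_zero (ω : Form) (hω : IsForm 2 ω) (u : Finset (Fin 8)) (hu : u.card ≠ 2) :
    evalL (row u) ω = 0 := by
  refine List.sum_eq_zero fun x hx => ?_
  obtain ⟨p, hp, rfl⟩ := List.mem_map.1 hx
  have := row_card u p hp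
  rw [hω p.2 (by omega), mul_zero]

lemma T_isForm (ω : Form) (hω : IsForm 2 ω) : IsForm 2 (hodge (wedge Phi ω)) :=
  fun u hu => by rw [T_eq, row_zero ω hω u hu]

/-- The rows of the matrix of `⋆(Φ ∧ ·)` at the pairs. -/
def tab : List (Finset (Fin 8) × List (ℤ × Finset (Fin 8))) :=
  [({0,1}, [(1, {2,3}), (-1, {4,5}), (-1, {6,7})]),
   ({0,2}, [(-1, {1,3}), (-1, {4,6}), (1, {5,7})]),
   ({0,3}, [(1, {1,2}), (-1, {4,7}), (-1, {5,6})]),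
   ({0,4}, [(1, {1,5}), (1, {2,6}), (1, {3,7})]),
   ({0,5}, [(-1, {1,4}), (-1, {2,7}), (1, {3,6})]),
   ({0,6}, [(1, {1,7}), (-1, {2,4}), (-1, {3,5})]),
   ({0,7}, [(-1, {1,6}), (1, {2,5}), (-1, {3,4})]),
   ({1,2}, [(-1, {5,6}), (-1, {4,7}), (1, {0,3})]),
   ({1,3}, [(-1, {5,7}), (1, {4,6}), (-1, {0,2})]),
   ({1,4}, [(-1, {3,6}), (1, {2,7}), (-1, {0,5})]),
   ({1,5}, [(1, {3,7}), (1, {2,6}), (1, {0,4})]),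
   ({1,6}, [(1, {3,4}), (-1, {2,5}), (-1, {0,7})]),
   ({1,7}, [(-1, {3,5}), (-1, {2,4}), (1, {0,6})]),
   ({2,3}, [(-1, {6,7}), (-1, {4,5}), (1, {0,1})]),
   ({2,4}, [(1, {3,5}), (-1, {1,7}), (-1, {0,6})]),
   ({2,5}, [(-1, {3,4}), (-1, {1,6}), (1, {0,7})]),
   ({2,6}, [(1, {3,7}), (1, {1,5}), (1, {0,4})]),
   ({2,7}, [(-1, {3,6}), (1, {1,4}), (-1, {0,5})]),
   ({3,4}, [(-1, {2,5}), (1, {1,6}), (-1, {0,7})]),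
   ({3,5}, [(1, {2,4}), (-1, {1,7}), (-1, {0,6})]),
   ({3,6}, [(-1, {2,7}), (-1, {1,4}), (1, {0,5})]),
   ({3,7}, [(1, {2,6}), (1, {1,5}), (1, {0,4})]),
   ({4,5}, [(1, {6,7}), (-1, {2,3}), (-1, {0,1})]),
   ({4,6}, [(-1, {5,7}), (1, {1,3}), (-1, {0,2})]),
   ({4,7}, [(1, {5,6}), (-1, {1,2}), (-1, {0,3})]),
   ({5,6}, [(1, {4,7}), (-1, {1,2}), (-1, {0,3})]),
   ({5,7}, [(-1, {4,6}), (-1, {1,3}), (1, {0,2})]),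
   ({6,7}, [(1, {4,5}), (-1, {2,3}), (-1, {0,1})])]

lemma tab_row : ∀ q ∈ tab, row q.1 = q.2 := by
  decide +kernel

lemma pair_mem_tab : ∀ i j : Fin 8, i ≠ j →
    ({i, j} : Finset (Fin 8)) ∈ tab.map Prod.fst := by
  decide +kernel

lemma tab_quadratic (β : Form) : ∀ u ∈ tab.map Prod.fst,
    hodge (wedge Phi (hodge (wedge Phi β))) u = 2 * hodge (wedge Phi β) u + 3 * β u := by
  have h : ∀ q ∈ tab, ∀ γ : Form, hodge (wedge Phi γ) q.1 = evalL q.2 γ := fun q hq γ => by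
    rw [T_eq, tab_row q hq]
  simp only [tab, List.forall_mem_cons, evalL_cons, evalL_nil, List.map_cons] at h ⊢
  simp only [List.map_nil, List.not_mem_nil, IsEmpty.forall_iff, implies_true, and_true] at h ⊢
  simp only [h]
  push_cast
  refine ⟨?_, ?_, ?_, ?_, ?_, ?_, ?_, ?_, ?_, ?_, ?_, ?_, ?_, ?_, ?_, ?_, ?_, ?_, ?_, ?_, ?_,
    ?_, ?_, ?_, ?_, ?_, ?_, ?_⟩ <;> ring

/-- the operator ω ↦ ⋆(Φ ∧ ω) on 2-forms satisfies
(⋆(Φ∧·) - 3 Id)(⋆(Φ∧·) + Id) = 0, i.e. ⋆(Φ ∧ ⋆(Φ ∧ ω)) = 2 ⋆(Φ ∧ ω) + 3 ω. -/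
theorem star_phi_wedge_quadratic (ω : Form) (hω : IsForm 2 ω) :
    hodge (wedge Phi (hodge (wedge Phi ω))) = (2 : ℝ) • hodge (wedge Phi ω) + (3 : ℝ) • ω := by
  funext u
  simp only [Pi.add_apply, Pi.smul_apply, smul_eq_mul]
  by_cases hu : u.card = 2
  · obtain ⟨i, j, hij, rfl⟩ := Finset.card_eq_two.1 hu
    exact tab_quadratic ω _ (pair_mem_tab i j hij)
  · rw [T_isForm _ (T_isForm ω hω) u hu, T_isForm ω hω u hu, hω u hu]
    simp

end
end

section
/- For the Cayley 4-form Φ on ℝ^8 and any vectors v, w ∈ ℝ^8: ⋆((v⌟Φ) ∧ (w⌟Φ)) = 2(v^♭ ∧ w^♭)_7 - 6(v^♭ ∧ w^♭)_{21}. -/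
open Finset

noncomputable section

/-! ### Integer models of the coefficients -/

/-- Integer version of `esign`. -/
def esZ (t u : Finset (Fin 8)) : ℤ :=
  (-1 : ℤ) ^ ((t ×ˢ u).filter (fun p => p.2 < p.1)).card

/-- Integer version of `eS`. -/
def eZ (s : Finset (Fin 8)) : Finset (Fin 8) → ℤ := fun t => if t = s then 1 else 0

/-- Integer version of `Phi`. -/
def phiZ : Finset (Fin 8) → ℤ :=
  eZ {0,1,2,3} - eZ {0,1,4,5} - eZ {0,1,6,7} - eZ {0,2,4,6} + eZ {0,2,5,7}
  - eZ {0,3,4,7} - eZ {0,3,5,6} + eZ {4,5,6,7} - eZ {2,3,6,7} - eZ {2,3,4,5}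
  - eZ {1,3,5,7} + eZ {1,3,4,6} - eZ {1,2,5,6} - eZ {1,2,4,7}

/-- Binary code of a set of indices. -/
def code (s : Finset (Fin 8)) : ℕ := ∑ i ∈ s, 2 ^ (i : ℕ)

/-- `phiZ`, read off from the binary code. -/
def phiC (s : Finset (Fin 8)) : ℤ :=
  if code s ∈ [15, 165, 240, 90] then 1
  else if code s ∈ [51, 195, 85, 153, 105, 204, 60, 170, 102, 150] then -1 else 0

/-- Integer version of `iota i Phi`. -/
def iotaZ (i : Fin 8) (s : Finset (Fin 8)) : ℤ :=
  if i ∈ s then 0 else (-1 : ℤ) ^ (s.filter (· < i)).card * phiC (insert i s)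

/-- Integer version of the wedge product. -/
def wedgeZ (a b : Finset (Fin 8) → ℤ) (s : Finset (Fin 8)) : ℤ :=
  ∑ t ∈ s.powerset, esZ t (s \ t) * a t * b (s \ t)

lemma esZ_cast (t u : Finset (Fin 8)) : esign t u = (esZ t u : ℝ) := by
  simp [esign, esZ]

lemma eZ_cast (s t : Finset (Fin 8)) : eS s t = (eZ s t : ℝ) := by
  simp [eS, eZ]

lemma phiZ_eq_phiC : ∀ s, phiZ s = phiC s := by
  decide +kernel

lemma phiC_cast (s : Finset (Fin 8)) : Phi s = (phiC s : ℝ) := by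
  rw [← phiZ_eq_phiC]
  simp only [Phi, phiZ, Pi.add_apply, Pi.sub_apply, eZ_cast]
  push_cast
  rfl

lemma iotaZ_cast (i : Fin 8) (s : Finset (Fin 8)) : iota i Phi s = (iotaZ i s : ℝ) := by
  simp only [iota, iotaZ, phiC_cast]
  split_ifs <;> simp

/-- Bilinear expansion of a wedge product. -/
lemma wedge_expand (v w : Fin 8 → ℝ) (a b : Fin 8 → Finset (Fin 8) → ℤ) (s : Finset (Fin 8)) :
    wedge (fun t => ∑ i, v i * (a i t : ℝ)) (fun t => ∑ i, w i * (b i t : ℝ)) s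
      = ∑ i, ∑ j, v i * w j * (wedgeZ (a i) (b j) s : ℝ) := by
  simp only [wedge, wedgeZ, esZ_cast]
  push_cast
  have key : ∀ t : Finset (Fin 8), (esZ t (s \ t) : ℝ) * (∑ i, v i * (a i t : ℝ)) *
      (∑ j, w j * (b j (s \ t) : ℝ)) =
      ∑ i, ∑ j, v i * w j * ((esZ t (s \ t) : ℝ) * a i t * b j (s \ t)) := by
    intro t
    rw [mul_assoc, Finset.sum_mul_sum, Finset.mul_sum]
    refine Finset.sum_congr rfl fun i _ => ?_
    rw [Finset.mul_sum]
    exact Finset.sum_congr rfl fun j _ => by ring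
  simp only [key]
  simp only [Finset.mul_sum]
  rw [Finset.sum_comm]
  exact Finset.sum_congr rfl fun i _ => Finset.sum_comm

/-- Linear expansion of `Phi ∧ α`. -/
lemma wedge_Phi_expand (v w : Fin 8 → ℝ) (a : Fin 8 → Fin 8 → Finset (Fin 8) → ℤ)
    (s : Finset (Fin 8)) :
    wedge Phi (fun t => ∑ i, ∑ j, v i * w j * (a i j t : ℝ)) s
      = ∑ i, ∑ j, v i * w j * (wedgeZ phiC (a i j) s : ℝ) := by
  simp only [wedge, wedgeZ, esZ_cast, phiC_cast]
  push_cast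
  simp only [Finset.mul_sum]
  rw [Finset.sum_comm]
  refine Finset.sum_congr rfl fun i _ => ?_
  rw [Finset.sum_comm]
  exact Finset.sum_congr rfl fun j _ => Finset.sum_congr rfl fun t _ => by ring

lemma wedgeZ_eZ_left (a : Finset (Fin 8)) (b : Finset (Fin 8) → ℤ) (s : Finset (Fin 8)) :
    wedgeZ (eZ a) b s = if a ⊆ s then esZ a (s \ a) * b (s \ a) else 0 := by
  unfold wedgeZ eZ
  simp

/-- Wedge product of two basis covectors. -/
def alphaZ (i j : Fin 8) (s : Finset (Fin 8)) : ℤ :=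
  if i = j then 0 else if s = {i, j} then esZ {i} {j} else 0

lemma wedgeZ_basis (i j : Fin 8) : wedgeZ (eZ {i}) (eZ {j}) = alphaZ i j := by
  funext s
  rw [wedgeZ_eZ_left]
  unfold alphaZ eZ
  by_cases hij : i = j
  · subst hij
    have : s \ {i} ≠ {i} := by
      intro h
      have : i ∈ s \ {i} := by rw [h]; simp
      simp at this
    simp [this]
  · by_cases hs : s = {i, j}
    · subst hs
      have : ({i, j} : Finset (Fin 8)) \ {i} = {j} := by
        ext x; simp; grind
      simp [this, hij]
    · by_cases hi : {i} ⊆ s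
      · have : s \ {i} ≠ {j} := by
          intro h
          apply hs
          rw [← Finset.union_sdiff_of_subset hi, h]
          rfl
        simp [this, hs]
      · simp [hi, hs]

/-- `Phi ∧ e^i ∧ e^j`. -/
def betaZ (i j : Fin 8) (s : Finset (Fin 8)) : ℤ :=
  if i = j then 0 else if {i, j} ⊆ s then
    esZ (s \ {i, j}) {i, j} * phiC (s \ {i, j}) * esZ {i} {j} else 0

lemma wedgeZ_phiC_alphaZ (i j : Fin 8) (s : Finset (Fin 8)) :
    wedgeZ phiC (alphaZ i j) s = betaZ i j s := by
  unfold wedgeZ alphaZ betaZ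
  by_cases hij : i = j
  · simp [hij]
  simp only [hij, if_false]
  by_cases hs : {i, j} ⊆ s
  · rw [Finset.sum_eq_single (s \ {i, j})]
    · simp only [Finset.sdiff_sdiff_eq_self hs, hs, if_true]
    · intro t ht hne
      have ht' := Finset.mem_powerset.1 ht
      rw [if_neg, mul_zero]
      intro h
      exact hne (by rw [← h, Finset.sdiff_sdiff_eq_self ht'])
    · intro h
      exact absurd (Finset.mem_powerset.2 Finset.sdiff_subset) h
  · rw [if_neg hs]
    refine Finset.sum_eq_zero fun t _ => ?_
    rw [if_neg, mul_zero]
    intro h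
    exact hs (h ▸ Finset.sdiff_subset)

/-- Nim-sum of the elements of a set of indices. The blocks of `Phi` have nim-sum zero. -/
def xorS (s : Finset (Fin 8)) : ℕ :=
  s.fold (fun x y : ℕ => x ^^^ y) 0 (fun i : Fin 8 => (i : ℕ))

lemma xorS_sdiff {s t : Finset (Fin 8)} (h : t ⊆ s) : xorS s = xorS t ^^^ xorS (s \ t) := by
  have h1 := Finset.fold_disjUnion (op := fun x y : ℕ => x ^^^ y) (f := fun i : Fin 8 => (i : ℕ))
    (b₁ := 0) (b₂ := 0) (Finset.disjoint_sdiff (s := t) (t := s))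
  rw [Finset.disjUnion_eq_union, Finset.union_sdiff_of_subset h] at h1
  exact h1

/-- Support of `iotaZ`. -/
lemma iotaZ_supp : ∀ s i, iotaZ i s ≠ 0 → s.card = 3 ∧ xorS s = (i : ℕ) := by
  decide +kernel

lemma iotaZ_card (i : Fin 8) (s : Finset (Fin 8)) (h : iotaZ i s ≠ 0) : s.card = 3 :=
  (iotaZ_supp s i h).1

lemma iotaZ_xorS (i : Fin 8) (s : Finset (Fin 8)) (h : iotaZ i s ≠ 0) : xorS s = (i : ℕ) :=
  (iotaZ_supp s i h).2

/-- Support of `phiC`. -/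
lemma phiC_card : ∀ s, phiC s ≠ 0 → s.card = 4 := by
  decide +kernel

/-- `wedgeZ (iotaZ i) (iotaZ j)` written in a way that evaluates quickly. -/
def gammaZ (i j : Fin 8) (s : Finset (Fin 8)) : ℤ :=
  if xorS s = (i : ℕ) ^^^ (j : ℕ) then
    ∑ t ∈ s.powersetCard 3, if xorS t = (i : ℕ) then
      esZ t (s \ t) * iotaZ i t * iotaZ j (s \ t) else 0
  else 0

lemma wedgeZ_iotaZ (i j : Fin 8) (s : Finset (Fin 8)) :
    wedgeZ (iotaZ i) (iotaZ j) s = gammaZ i j s := by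
  unfold wedgeZ gammaZ
  split_ifs with hs
  · symm
    have : ∀ t, (if xorS t = (i : ℕ) then
        esZ t (s \ t) * iotaZ i t * iotaZ j (s \ t) else 0) =
        esZ t (s \ t) * iotaZ i t * iotaZ j (s \ t) := by
      intro t
      split_ifs with h1
      · rfl
      · have : iotaZ i t = 0 := by
          by_contra h
          exact h1 (iotaZ_xorS i t h)
        simp [this]
    simp only [this]
    refine Finset.sum_subset (fun t ht => ?_) fun t ht hn => ?_
    · exact Finset.mem_powerset.2 (Finset.mem_powersetCard.1 ht).1
    · by_cases h0 : iotaZ i t = 0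
      · simp [h0]
      · exact absurd (Finset.mem_powersetCard.2 ⟨Finset.mem_powerset.1 ht, iotaZ_card i t h0⟩) hn
  · refine Finset.sum_eq_zero fun t ht => ?_
    by_cases h0 : iotaZ i t = 0
    · simp [h0]
    by_cases h1 : iotaZ j (s \ t) = 0
    · simp [h1]
    exact absurd (by rw [xorS_sdiff (Finset.mem_powerset.1 ht), iotaZ_xorS i t h0,
      iotaZ_xorS j _ h1]) hs

lemma core_two : ∀ u ∈ Finset.powersetCard 2 (univ : Finset (Fin 8)), ∀ i j : Fin 8,
    esZ uᶜ u * gammaZ i j uᶜ = -4 * alphaZ i j u + 2 * (esZ uᶜ u * betaZ i j uᶜ) := by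
  decide +kernel

lemma core (u : Finset (Fin 8)) (i j : Fin 8) :
    esZ uᶜ u * gammaZ i j uᶜ = -4 * alphaZ i j u + 2 * (esZ uᶜ u * betaZ i j uᶜ) := by
  by_cases hu : u.card = 2
  · exact core_two u (Finset.mem_powersetCard.2 ⟨Finset.subset_univ _, hu⟩) i j
  have hc : uᶜ.card ≠ 6 := by
    have h1 := Finset.card_add_card_compl u
    simp only [Fintype.card_fin] at h1
    omega
  have hg : gammaZ i j uᶜ = 0 := by
    rw [← wedgeZ_iotaZ]
    refine Finset.sum_eq_zero fun t ht => ?_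
    by_cases h0 : iotaZ i t = 0
    · simp [h0]
    by_cases h1 : iotaZ j (uᶜ \ t) = 0
    · simp [h1]
    have h2 := iotaZ_card _ _ h0
    have h3 := iotaZ_card _ _ h1
    have h4 := Finset.card_sdiff_add_card_eq_card (Finset.mem_powerset.1 ht)
    omega
  have ha : alphaZ i j u = 0 := by
    unfold alphaZ
    split_ifs with h1 h2
    · rfl
    · exact absurd (h2 ▸ Finset.card_pair h1) hu
    · rfl
  have hb : betaZ i j uᶜ = 0 := by
    unfold betaZ
    split_ifs with h1 h2
    · rfl
    · have : phiC (uᶜ \ {i, j}) = 0 := by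
        by_contra h
        have h3 := phiC_card _ h
        have h4 := Finset.card_sdiff_add_card_eq_card h2
        rw [Finset.card_pair h1] at h4
        omega
      simp [this]
    · rfl
  simp [hg, ha, hb]

/-- for all vectors v, w,
⋆((v⌟Φ) ∧ (w⌟Φ)) = 2 (v♭ ∧ w♭)_7 - 6 (v♭ ∧ w♭)_21. -/
theorem star_contraction_wedge_contraction (v w : Fin 8 → ℝ) :
    hodge (wedge (iotaV v Phi) (iotaV w Phi)) =
      (2 : ℝ) • proj7 (wedge (flat v) (flat w)) - (6 : ℝ) • proj21 (wedge (flat v) (flat w)) := by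
  have h1 : ∀ s, wedge (iotaV v Phi) (iotaV w Phi) s =
      ∑ i, ∑ j, v i * w j * (gammaZ i j s : ℝ) := by
    intro s
    have e : ∀ x : Fin 8 → ℝ, iotaV x Phi = fun t => ∑ i, x i * (iotaZ i t : ℝ) := by
      intro x
      funext t
      simp only [iotaV, iotaZ_cast]
    rw [e v, e w, wedge_expand]
    simp only [wedgeZ_iotaZ]
  have h2 : wedge (flat v) (flat w) = fun s => ∑ i, ∑ j, v i * w j * (alphaZ i j s : ℝ) := by
    funext s
    have e : ∀ x : Fin 8 → ℝ, flat x = fun t => ∑ i, x i * (eZ {i} t : ℝ) := by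
      intro x
      funext t
      simp only [flat, eZ_cast]
    rw [e v, e w, wedge_expand v w (fun i => eZ {i}) (fun i => eZ {i})]
    simp only [wedgeZ_basis]
  have h3 : ∀ s, wedge Phi (wedge (flat v) (flat w)) s =
      ∑ i, ∑ j, v i * w j * (betaZ i j s : ℝ) := by
    intro s
    rw [h2, wedge_Phi_expand]
    simp only [wedgeZ_phiC_alphaZ]
  funext u
  have h4 : hodge (wedge (iotaV v Phi) (iotaV w Phi)) u =
      -4 * wedge (flat v) (flat w) u + 2 * hodge (wedge Phi (wedge (flat v) (flat w))) u := by
    simp only [hodge, h1, h3, esZ_cast]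
    rw [h2]
    simp only [Finset.mul_sum, ← Finset.sum_add_distrib]
    refine Finset.sum_congr rfl fun i _ => Finset.sum_congr rfl fun j _ => ?_
    have hcore : (esZ uᶜ u : ℝ) * gammaZ i j uᶜ =
        -4 * alphaZ i j u + 2 * (esZ uᶜ u * betaZ i j uᶜ) := by
      exact_mod_cast core u i j
    linear_combination (v i * w j) * hcore
  rw [h4]
  simp only [proj7, proj21, Pi.sub_apply, Pi.smul_apply, Pi.add_apply, smul_eq_mul]
  ring

end
end
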